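/- Let w be a finite word over the alphabet {a,b} of the form w = a^{r_1} b a^{r_2} b ... a^{r_k} b a^{r_{k+1}}, where r_1, ..., r_{k+1} are nonnegative integers, with |w|_a ≥ |w|_b = k ≥ 1. Let δ = |w|_a − k and n = ⌊δ/(k+1)⌋. Let σ be a permutation of {1, ..., k+1} with r_{σ(1)} ≤ ... ≤ r_{σ(k+1)}. If 1 + ⌊3(n+1)/2⌋ ≤ ⌊(r_{σ(k+1)} − 1)/2⌋ + r_{σ(k)}, then s(w) ≤ ((2k−1)/(2k+2))·|w|. -/

import Mathlib

/-- `numPowers w` is the number of distinct nonempty factors of `w` that are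
powers of exponent at least 2, i.e. of the form `u^j` with `u` nonempty and `j ≥ 2`. -/
noncomputable def numPowers {α : Type*} (w : List α) : ℕ :=
  Set.ncard {v : List α | v <:+: w ∧
    ∃ u : List α, u ≠ [] ∧ ∃ j : ℕ, 2 ≤ j ∧ v = (List.replicate j u).flatten}

/-- `numSquares w` is the number of distinct squares occurring as factors of `w`. -/
noncomputable def numSquares {α : Type*} (w : List α) : ℕ :=
  Set.ncard {v : List α | v <:+: w ∧ ∃ u : List α, u ≠ [] ∧ v = u ++ u}

/-- The binary word `a^{r 0} b a^{r 1} b ⋯ a^{r (k-1)} b a^{r k}` over the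
alphabet `Bool`, where `a := false` and `b := true`. -/
def binWord (k : ℕ) (r : Fin (k + 1) → ℕ) : List Bool :=
  (List.ofFn (fun j : Fin k => List.replicate (r j.castSucc) false ++ [true])).flatten
    ++ List.replicate (r (Fin.last k)) false

/-- The length-`L` window of the infinite word `f` starting at position `i`. -/
def window (f : ℕ → Bool) (i L : ℕ) : List Bool :=
  List.ofFn fun j : Fin L => f (i + j)

@[simp]
theorem length_window (f : ℕ → Bool) (i L : ℕ) : (window f i L).length = L := by
  simp [window]

theorem window_eq_window_iff {f g : ℕ → Bool} {i j L : ℕ} :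
    window f i L = window g j L ↔ ∀ t < L, f (i + t) = g (j + t) := by
  simp [window, List.ofFn_inj, funext_iff, Fin.forall_iff]

theorem eq_window_iff {f : ℕ → Bool} {v : List Bool} {i : ℕ} :
    v = window f i v.length ↔ ∀ t (h : t < v.length), v[t] = f (i + t) := by
  constructor
  · intro h t ht
    rw [List.getElem_of_eq h ht]
    simp [window]
  · intro h
    refine List.ext_getElem (by simp) fun t h₁ h₂ => ?_
    rw [h t h₁]
    simp [window]

theorem window_add (f : ℕ → Bool) (i p q : ℕ) :
    window f i (p + q) = window f i p ++ window f (i + p) q := by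
  simp [window, List.ofFn_add, Nat.add_assoc]

theorem window_infix_window (f : ℕ → Bool) (i : ℕ) {s L M : ℕ} (h : s + L ≤ M) :
    window f (i + s) L <:+: window f i M := by
  obtain ⟨c, rfl⟩ := Nat.exists_eq_add_of_le h
  exact ⟨window f i s, window f (i + (s + L)) c, by rw [window_add, window_add]⟩

theorem window_dropLast (f : ℕ → Bool) (i L : ℕ) :
    (window f i (L + 1)).dropLast = window f i L := by
  rw [window_add, window.eq_def f (i + L)]
  simp

theorem window_tail (f : ℕ → Bool) (i L : ℕ) :
    (window f i (L + 1)).tail = window f (i + 1) L := by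
  rw [Nat.add_comm L 1, window_add, window.eq_def f i 1]
  simp

/-- The infinite word extending `w` by `false`. -/
def extend (w : List Bool) : ℕ → Bool := fun i => w.getD i false

theorem infix_iff_eq_window {v w : List Bool} :
    v <:+: w ↔ ∃ i, i + v.length ≤ w.length ∧ v = window (extend w) i v.length := by
  simp only [eq_window_iff, List.infix_iff_getElem?, extend]
  refine exists_congr fun i => ?_
  rw [Nat.add_comm]
  refine and_congr_right fun hi => forall₂_congr fun t ht => ?_
  have hlt : i + t < w.length := by omega
  simp [Nat.add_comm t i, hlt, eq_comm]

theorem infix_window_extend {w : List Bool} {i L : ℕ} (h : i + L ≤ w.length) :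
    window (extend w) i L <:+: w :=
  infix_iff_eq_window.2 ⟨i, by simpa using h, by simp⟩

theorem window_mod {g : ℕ → Bool} {m : ℕ} (hg : Function.Periodic g m) (i L : ℕ) :
    window g (i % m) L = window g i L := by
  rw [window_eq_window_iff]
  intro t _
  rw [← hg.map_mod_nat (i % m + t), ← hg.map_mod_nat (i + t), Nat.mod_add_mod]

/-- The binary value of a window, read with the least significant digit first. -/
def windowVal (f : ℕ → Bool) : ℕ → ℕ → ℕ
  | _, 0 => 0
  | i, L + 1 => (f i).toNat + 2 * windowVal f (i + 1) L

theorem windowVal_add (f : ℕ → Bool) (i p q : ℕ) :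
    windowVal f i (p + q) = windowVal f i p + 2 ^ p * windowVal f (i + p) q := by
  induction p generalizing i with
  | zero => simp [windowVal]
  | succ p ih =>
    rw [Nat.add_right_comm, windowVal, windowVal, ih, Nat.add_right_comm i, Nat.add_assoc i]
    ring

theorem windowVal_eq_iff {f g : ℕ → Bool} {i j L : ℕ} :
    windowVal f i L = windowVal g j L ↔ ∀ t < L, f (i + t) = g (j + t) := by
  induction L generalizing i j with
  | zero => simp [windowVal]
  | succ L ih =>
    have key : windowVal f i (L + 1) = windowVal g j (L + 1) ↔
        f i = g j ∧ windowVal f (i + 1) L = windowVal g (j + 1) L := by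
      simp only [windowVal]
      cases f i <;> cases g j <;> simp <;> omega
    rw [key, ih]
    constructor
    · rintro ⟨h0, h⟩ t ht
      cases t with
      | zero => simpa using h0
      | succ t => simpa [Nat.add_assoc, Nat.add_comm 1] using h t (by omega)
    · intro h
      refine ⟨by simpa using h 0 (by omega), fun t ht => ?_⟩
      simpa [Nat.add_assoc, Nat.add_comm 1] using h (t + 1) (by omega)

theorem windowVal_shift (f : ℕ → Bool) (a i L : ℕ) :
    windowVal (fun n => f (a + n)) i L = windowVal f (a + i) L := by
  induction L generalizing i with
  | zero => rfl
  | succ L ih => simp [windowVal, ih, Nat.add_assoc]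

/-- `g` has period `m`, and its prefix of length `m` is a Lyndon word: strictly smaller than its
other rotations. -/
structure IsLyndonPeriodic (g : ℕ → Bool) (m : ℕ) : Prop where
  pos : 0 < m
  periodic : Function.Periodic g m
  lt : ∀ d, 0 < d → d < m → windowVal g 0 m < windowVal g d m

namespace IsLyndonPeriodic

variable {g h : ℕ → Bool} {m n : ℕ}

/-- A Lyndon word is unbordered. -/
theorem exists_ne (hg : IsLyndonPeriodic g m) {d : ℕ} (hd : 0 < d) (hdm : d < m) :
    ∃ j, j + d < m ∧ g j ≠ g (j + d) := by
  by_contra! hcon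
  obtain ⟨s, rfl⟩ := Nat.exists_eq_add_of_le hdm.le
  have hS : windowVal g 0 s = windowVal g d s := by
    rw [windowVal_eq_iff]
    intro t ht
    simpa [Nat.add_comm] using hcon t (by omega)
  have hB : windowVal g (d + s) d = windowVal g 0 d := by
    rw [windowVal_eq_iff]
    intro t _
    rw [Nat.add_comm, hg.periodic, Nat.zero_add]
  have hS' : windowVal g (s + d) s = windowVal g 0 s := by
    rw [windowVal_eq_iff]
    intro t _
    rw [Nat.add_comm s, Nat.add_comm, hg.periodic, Nat.zero_add]
  have h₁ := hg.lt d hd hdm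
  have h₂ := hg.lt s (by omega) (by omega)
  have e₁ := windowVal_add g 0 d s
  have e₂ := windowVal_add g 0 s d
  have e₃ := windowVal_add g d s d
  have e₄ := windowVal_add g s d s
  rw [Nat.add_comm s d] at e₂ e₃ e₄
  rw [Nat.add_comm s d] at hS'
  simp only [Nat.zero_add] at e₁ e₂
  rw [e₃, e₂, hB, hS] at h₁
  rw [e₄, e₁, hS', hS] at h₂
  have := Nat.lt_of_mul_lt_mul_left (Nat.lt_of_add_lt_add_left h₁)
  omega

theorem eq_of_eqOn (hg : IsLyndonPeriodic g m) (hh : Function.Periodic h m)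
    (heq : ∀ t < m, g t = h t) : g = h := by
  funext t
  rw [← hg.periodic.map_mod_nat t, ← hh.map_mod_nat t]
  exact heq _ (Nat.mod_lt _ hg.pos)

theorem le_of_agree (hg : IsLyndonPeriodic g m) (hh : Function.Periodic h n) (hn : 0 < n)
    {i L : ℕ} (hm : m ≤ L) (heq : ∀ t < L, g t = h (i + t)) : m ≤ n := by
  by_contra! hlt
  obtain ⟨j, hj, hne⟩ := hg.exists_ne hn hlt
  refine hne ?_
  rw [heq j (by omega), heq (j + n) (by omega), ← Nat.add_assoc, hh]

theorem eq_of_agree (hg : IsLyndonPeriodic g m) (hh : IsLyndonPeriodic h n) {L : ℕ}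
    (hm : m ≤ L) (hn : n ≤ L) (heq : ∀ t < L, g t = h t) : g = h ∧ m = n := by
  have hmn : m = n := le_antisymm
    (hg.le_of_agree hh.periodic hh.pos (i := 0) hm (by simpa using heq))
    (hh.le_of_agree hg.periodic hg.pos (i := 0) hn (by simpa using fun t ht => (heq t ht).symm))
  subst hmn
  exact ⟨hg.eq_of_eqOn hh.periodic fun t ht => heq t (by omega), rfl⟩

/-- The Lyndon rotation is unique. -/
theorem eq_zero_of_agree (hg : IsLyndonPeriodic g m) (hh : IsLyndonPeriodic h m) {i : ℕ}
    (hi : i < m) (heq : ∀ t < m, h t = g (i + t)) : i = 0 := by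
  by_contra hne
  have h₀ : windowVal h 0 m = windowVal g i m := by
    rw [windowVal_eq_iff]
    simpa using heq
  have hperm : h = fun n => g (i + n) := by
    refine hh.eq_of_eqOn (fun t => ?_) heq
    simp only [← Nat.add_assoc]
    exact hg.periodic _
  have h₁ : windowVal h (m - i) m = windowVal g 0 m := by
    rw [hperm, windowVal_shift, Nat.add_sub_cancel' hi.le, windowVal_eq_iff]
    intro t _
    rw [Nat.add_comm, hg.periodic, Nat.zero_add]
  have h₂ := hg.lt i (by omega) hi
  have h₃ := hh.lt (m - i) (by omega) (by omega)
  omega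

end IsLyndonPeriodic

theorem exists_isLyndonPeriodic_shift {f : ℕ → Bool} {m : ℕ} (hm : 0 < m)
    (hf : Function.Periodic f m) (hmin : ∀ d, 0 < d → d < m → ¬ Function.Periodic f d) :
    ∃ a, IsLyndonPeriodic (fun n => f (a + n)) m := by
  obtain ⟨a, ha⟩ : ∃ a, ∀ i, windowVal f a m ≤ windowVal f i m :=
    ⟨_, fun i => Function.argmin_le (fun i => windowVal f i m) i⟩
  have hper : Function.Periodic (fun n => f (a + n)) m := fun t => by
    simp only [← Nat.add_assoc]
    exact hf _
  refine ⟨a, hm, hper, fun d hd hdm => ?_⟩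
  rw [windowVal_shift, windowVal_shift]
  refine lt_of_le_of_ne (ha _) fun heq => hmin d hd hdm ?_
  rw [windowVal_eq_iff] at heq
  have hshift : ∀ t, f (a + t) = f (a + t + d) := fun t => by
    have h₁ := hper.map_mod_nat t
    have h₂ := hper.map_mod_nat (t + d)
    rw [← Nat.mod_add_mod, hper.map_mod_nat] at h₂
    have := heq (t % m) (Nat.mod_lt _ hm)
    simp only [Nat.add_zero, Nat.add_right_comm _ d, ← Nat.add_assoc] at this h₁ h₂
    rw [← h₁, ← h₂, this]
  intro t
  have hback : ∀ x, f (x + a * m) = f x := hf.nat_mul a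
  have hle : a ≤ a * m := Nat.le_mul_of_pos_right a hm
  have := hshift (t + a * m - a)
  rw [Nat.add_sub_cancel' (by omega), Nat.add_right_comm, hback, hback] at this
  exact this.symm

/-- The factors `e` of `w` that are prefixes of an infinite word `g` whose period is a Lyndon word
shorter than `e`, such that all windows of `g` of length `|e|` are factors of `w`. In the Rauzy
graph of order `|e| - 1` these windows form a circuit of which `e` is an edge. -/
def circuitEdges (w : List Bool) : Set (List Bool) :=
  {e | ∃ g m, IsLyndonPeriodic g m ∧ m < e.length ∧ e = window g 0 e.length ∧
    ∀ i, window g i e.length <:+: w}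

theorem infix_of_mem_circuitEdges {w e : List Bool} (h : e ∈ circuitEdges w) : e <:+: w := by
  obtain ⟨g, m, -, -, he, hall⟩ := h
  exact he ▸ hall 0

theorem finite_infixes (w : List Bool) : {v | v <:+: w}.Finite :=
  (List.finite_length_le Bool w.length).subset fun _ hv => List.IsInfix.length_le hv

theorem finite_circuitEdges (w : List Bool) : (circuitEdges w).Finite :=
  (finite_infixes w).subset fun _ => infix_of_mem_circuitEdges

/-- A word of exponent at least two is a power of a conjugate of a Lyndon word. -/
theorem exists_isLyndonPeriodic_of_power {u : List Bool} (hu : u ≠ []) {j : ℕ} (hj : 2 ≤ j) :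
    ∃ g m i J, IsLyndonPeriodic g m ∧ i < m ∧ 2 ≤ J ∧
      (List.replicate j u).flatten.length = J * m ∧
      (List.replicate j u).flatten = window g i (J * m) := by
  have hul : 0 < u.length := List.length_pos_iff.2 hu
  set f : ℕ → Bool := fun i => u[i % u.length]'(Nat.mod_lt _ hul) with hfdef
  have hfu : Function.Periodic f u.length := fun i => by simp [hfdef]
  have hv : ∀ j, (List.replicate j u).flatten = window f 0 (j * u.length) := by
    intro j
    induction j with
    | zero => simp [window]
    | succ j ih =>
      rw [List.replicate_succ, List.flatten_cons, ih, Nat.succ_mul, Nat.add_comm, window_add]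
      congr 1
      · rw [eq_window_iff]
        intro t ht
        simp [hfdef, Nat.mod_eq_of_lt ht]
      · rw [window_eq_window_iff]
        intro t _
        rw [Nat.zero_add, Nat.zero_add, Nat.add_comm, hfu]
  have hex : ∃ d, 0 < d ∧ Function.Periodic f d := ⟨_, hul, hfu⟩
  classical
  obtain ⟨m, ⟨hm, hfm⟩, hmin⟩ :
      ∃ m, (0 < m ∧ Function.Periodic f m) ∧ ∀ d, 0 < d → d < m → ¬ Function.Periodic f d :=
    ⟨Nat.find hex, Nat.find_spec hex, fun d hd hlt hp => Nat.find_min hex hlt ⟨hd, hp⟩⟩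
  have hdvd : m ∣ u.length := by
    rw [Nat.dvd_iff_mod_eq_zero]
    by_contra hne
    refine hmin _ (Nat.pos_of_ne_zero hne) (Nat.mod_lt _ hm) fun t => ?_
    have := hfm.nat_mul (u.length / m) (t + u.length % m)
    rw [← this, ← hfu t, Nat.add_assoc, Nat.cast_id, Nat.mul_comm, Nat.mod_add_div]
  obtain ⟨c, hc⟩ := hdvd
  have hcpos : 0 < c := Nat.pos_of_ne_zero fun h => by
    rw [h, Nat.mul_zero] at hc
    omega
  obtain ⟨a, hg⟩ := exists_isLyndonPeriodic_shift hm hfm hmin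
  have hlen : j * u.length = j * c * m := by rw [hc]; ring
  refine ⟨_, m, (a * m - a) % m, j * c, hg, Nat.mod_lt _ hm, by nlinarith, ?_, ?_⟩
  · rw [hv, length_window, hlen]
  · rw [window_mod hg.periodic, hv, hlen, window_eq_window_iff]
    intro t _
    have hle : a ≤ a * m := Nat.le_mul_of_pos_right a hm
    have hback : f (t + a * m) = f t := hfm.nat_mul a t
    rw [Nat.zero_add, ← Nat.add_assoc, Nat.add_sub_cancel' hle, Nat.add_comm, hback]

open Classical in
/-- If `t` of the `m` rotations of a power of exponent `J` with root length `m` are factors of `w`,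
then so are all windows of length `(J - 1) m + t`. -/
theorem window_infix_of_count {w : List Bool} {g : ℕ → Bool} {m : ℕ}
    (hg : Function.Periodic g m) {n t : ℕ} (ht₀ : 0 < t) (hmn : m ≤ n)
    (ht : t ≤ Nat.count (fun i => window g i n <:+: w) m) (x : ℕ) :
    window g x (n - m + t) <:+: w := by
  by_contra hx
  have hper : Function.Periodic (fun i => window g i n <:+: w) m := fun i => by
    simp only [← window_mod hg (i + m), Nat.add_mod_right, window_mod hg]
  rw [← Nat.filter_Ico_card_eq_of_periodic (x + 1) m _ hper] at ht
  have hsub : (Finset.Ico (x + 1) (x + 1 + m)).filter (fun i => window g i n <:+: w) ⊆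
      Finset.Ico (x + 1) (x + t) := by
    intro y hy
    rw [Finset.mem_filter, Finset.mem_Ico] at hy
    rw [Finset.mem_Ico]
    refine ⟨hy.1.1, ?_⟩
    by_contra! hle
    refine hx (List.IsInfix.trans ?_ hy.2)
    have := window_infix_window g y (s := x + m - y) (L := n - m + t) (M := n) (by omega)
    rwa [Nat.add_sub_cancel' (by omega), ← window_mod hg, Nat.add_mod_right, window_mod hg] at this
  have := Finset.card_le_card hsub
  rw [Nat.card_Ico] at this
  omega

/-- There are at least as many circuit edges as powers. -/
theorem numPowers_le_ncard_circuitEdges (w : List Bool) :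
    numPowers w ≤ (circuitEdges w).ncard := by
  classical
  have hchoice : ∀ v : List Bool, ∃ (g : ℕ → Bool) (m i J : ℕ),
      (∃ u : List Bool, u ≠ [] ∧ ∃ j : ℕ, 2 ≤ j ∧ v = (List.replicate j u).flatten) →
      IsLyndonPeriodic g m ∧ i < m ∧ 2 ≤ J ∧ v.length = J * m ∧ v = window g i (J * m) := by
    intro v
    by_cases h : ∃ u : List Bool, u ≠ [] ∧ ∃ j : ℕ, 2 ≤ j ∧ v = (List.replicate j u).flatten
    · obtain ⟨u, hu, j, hj, rfl⟩ := h
      obtain ⟨g, m, i, J, h⟩ := exists_isLyndonPeriodic_of_power hu hj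
      exact ⟨g, m, i, J, fun _ => h⟩
    · exact ⟨fun _ => false, 0, 0, 0, fun h' => absurd h' h⟩
  choose g m i J hspec using hchoice
  set t : List Bool → ℕ := fun v =>
    Nat.count (fun y => window (g v) y (J v * m v) <:+: w) (i v + 1) with ht
  have ht_pos : ∀ v, v <:+: w → v = window (g v) (i v) (J v * m v) → 0 < t v := by
    intro v hvw hv
    rw [ht]
    simp only [Nat.count_succ]
    rw [if_pos (hv ▸ hvw)]
    omega
  have ht_le : ∀ v, i v < m v → t v ≤ m v := fun v hi => (Nat.count_le _).trans hi
  have hm_le : ∀ v, 2 ≤ J v → 2 * m v ≤ J v * m v := fun v hJ => Nat.mul_le_mul_right _ hJ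
  refine Set.ncard_le_ncard_of_injOn (fun v => window (g v) 0 (J v * m v - m v + t v)) ?_ ?_
    (finite_circuitEdges w)
  · rintro v ⟨hvw, hpow⟩
    obtain ⟨hg, hi, hJ, -, hv⟩ := hspec v hpow
    have h₁ := ht_pos v hvw hv
    have h₂ := hm_le v hJ
    have h₃ := hg.pos
    refine ⟨g v, m v, hg, by rw [length_window]; omega, by simp, fun x => ?_⟩
    rw [length_window]
    exact window_infix_of_count hg.periodic h₁ (by omega)
      (Nat.count_monotone _ hi) x
  · rintro v ⟨hvw, hpow⟩ v' ⟨hvw', hpow'⟩ heq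
    obtain ⟨hg, hi, hJ, -, hv⟩ := hspec v hpow
    obtain ⟨hg', hi', hJ', -, hv'⟩ := hspec v' hpow'
    have h₁ := ht_pos v hvw hv
    have h₁' := ht_pos v' hvw' hv'
    have h₂ := hm_le v hJ
    have h₂' := hm_le v' hJ'
    have h₃ := ht_le v hi
    have h₃' := ht_le v' hi'
    have hlen : J v * m v - m v + t v = J v' * m v' - m v' + t v' := by
      simpa using congrArg List.length heq
    simp only at heq
    rw [← hlen, window_eq_window_iff] at heq
    obtain ⟨hgg, hmm⟩ := hg.eq_of_agree hg' (L := J v * m v - m v + t v) (by omega) (by omega)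
      (by simpa using heq)
    have hJJ : J v = J v' := by
      rw [← hmm] at hlen h₂' h₃'
      have e : J v * m v + t v = J v' * m v + t v' := by omega
      rcases lt_trichotomy (J v) (J v') with hlt | h | hlt
      · have := Nat.mul_le_mul_right (m v) (Nat.succ_le_of_lt hlt)
        rw [Nat.succ_mul] at this
        omega
      · exact h
      · have := Nat.mul_le_mul_right (m v) (Nat.succ_le_of_lt hlt)
        rw [Nat.succ_mul] at this
        omega
    have htt : t v = t v' := by
      rw [hJJ, hmm] at hlen
      omega
    have hii : i v = i v' := by
      rw [ht] at htt
      simp only [Nat.count_succ, ← hgg, ← hJJ, ← hmm] at htt hv'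
      rw [if_pos (hv ▸ hvw), if_pos (hv' ▸ hvw')] at htt
      exact Nat.count_injective (p := fun y => window (g v) y (J v * m v) <:+: w) (hv ▸ hvw)
        (hv' ▸ hvw') (by omega)
    rw [hv, hv', hgg, hii, hJJ, hmm]

/-- If the edges of a finite multigraph suffice to force every vertex coloring that is constant
along edges to be constant, then there are at most one more vertices than edges. -/
theorem card_le_card_add_one_of_coloring {V K : Type*} [Finite V] [Finite K] [Nonempty V]
    (s t : K → V)
    (h : ∀ c : V → Prop, (∀ e, c (s e) = c (t e)) → ∀ x y, c x = c y) :
    Nat.card V ≤ Nat.card K + 1 := by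
  let G : SimpleGraph V := SimpleGraph.fromRel fun x y => ∃ e, s e = x ∧ t e = y
  have hG : G.Connected := by
    refine SimpleGraph.Connected.mk fun x y => ?_
    rw [← h (fun z => G.Reachable x z) (fun e => ?_) x y]
    by_cases hst : s e = t e
    · rw [hst]
    · have hadj : G.Adj (s e) (t e) := ⟨hst, Or.inl ⟨e, rfl, rfl⟩⟩
      exact propext ⟨fun h => h.trans hadj.reachable, fun h => h.trans hadj.symm.reachable⟩
  refine hG.card_vert_le_card_edgeSet_add_one.trans (Nat.add_le_add_right ?_ 1)
  have hsurj : G.edgeSet ⊆ Set.range fun e => s(s e, t e) := by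
    intro z
    induction z using Sym2.ind with
    | _ x y =>
      rintro ⟨-, ⟨e, rfl, rfl⟩ | ⟨e, rfl, rfl⟩⟩
      · exact ⟨e, rfl⟩
      · exact ⟨e, Sym2.eq_swap⟩
  exact (Nat.card_mono (Set.finite_range _) hsurj).trans (Finite.card_range_le _)

/-- A coloring of the factors of length `l` that is constant along all edges outside
`circuitEdges w` and `X` is constant along circuits, provided that no edge of `X` has a period at
most `l`. -/
theorem coloring_eq_of_circuit {β : Type*} {w : List Bool} {l : ℕ} {X : Set (List Bool)}
    (hX : ∀ g m i, Function.Periodic g m → 0 < m → m ≤ l → window g i (l + 1) ∉ X)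
    {c : List Bool → β}
    (hc : ∀ f i, window f i (l + 1) <:+: w → window f i (l + 1) ∉ circuitEdges w →
      window f i (l + 1) ∉ X → c (window f i l) = c (window f (i + 1) l))
    {g : ℕ → Bool} {m : ℕ} (hg : IsLyndonPeriodic g m) (hml : m ≤ l)
    (hw : ∀ i, window g i (l + 1) <:+: w) (i : ℕ) :
    c (window g i l) = c (window g (i + 1) l) := by
  induction m using Nat.strong_induction_on generalizing g i with
  | _ m ih =>
    have hne : ∀ i, i % m ≠ 0 → c (window g i l) = c (window g (i + 1) l) := by
      intro i hi
      by_cases hmem : window g i (l + 1) ∈ circuitEdges w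
      · obtain ⟨g', m', hg', hm', heq, hw'⟩ := hmem
        rw [length_window] at hm' heq hw'
        rw [window_eq_window_iff] at heq
        simp only [Nat.zero_add] at heq
        rcases (hg'.le_of_agree hg.periodic hg.pos (Nat.le_of_lt hm')
          fun t ht => (heq t ht).symm).lt_or_eq with hlt | rfl
        · have e₁ : window g i l = window g' 0 l := by
            rw [window_eq_window_iff]
            intro t ht
            rw [heq t (by omega), Nat.zero_add]
          have e₂ : window g (i + 1) l = window g' (0 + 1) l := by
            rw [window_eq_window_iff]
            intro t ht
            rw [Nat.add_assoc, heq (1 + t) (by omega), Nat.zero_add]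
          rw [e₁, e₂]
          exact ih m' hlt hg' (by omega) hw' 0
        · refine absurd (hg.eq_zero_of_agree hg' (Nat.mod_lt i hg.pos) fun t ht => ?_) hi
          rw [← heq t (by omega), ← hg.periodic.map_mod_nat, ← hg.periodic.map_mod_nat (_ + t),
            Nat.mod_add_mod]
      · exact hc g i (hw i) hmem (hX g m i hg.periodic hg.pos hml)
    have hchain : ∀ s, s + 1 ≤ m → c (window g 1 l) = c (window g (s + 1) l) := by
      intro s
      induction s with
      | zero => simp
      | succ s ihs =>
        intro hs
        rw [ihs (by omega)]
        exact hne _ (by rw [Nat.mod_eq_of_lt (by omega)]; omega)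
    by_cases hi : i % m = 0
    · have h₁ := hchain (m - 1) (by have := hg.pos; omega)
      rw [Nat.sub_add_cancel hg.pos, ← window_mod hg.periodic m, Nat.mod_self] at h₁
      rw [← window_mod hg.periodic i, ← window_mod hg.periodic (i + 1), hi, ← h₁,
        ← window_mod hg.periodic 1, Nat.add_mod, hi, Nat.zero_add, Nat.mod_mod]
    · exact hne i hi

theorem dropLast_infix_self {α : Type*} (l : List α) : l.dropLast <:+: l :=
  ⟨[], l.drop (l.length - 1), by simp [List.dropLast_eq_take]⟩

/-- The number of distinct factors of `w` of length `l`. -/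
noncomputable def factorCount (w : List Bool) (l : ℕ) : ℕ :=
  {v | v <:+: w ∧ v.length = l}.ncard

/-- The cyclomatic number of the Rauzy graph of order `l` is at least the number of its circuit
edges and additional independent edges `X`. -/
theorem factorCount_add_ncard_le {w : List Bool} {l : ℕ} (hl : l < w.length)
    {X : Set (List Bool)} (hXw : ∀ e ∈ X, e <:+: w ∧ e.length = l + 1)
    (hX : ∀ g m i, Function.Periodic g m → 0 < m → m ≤ l → window g i (l + 1) ∉ X)
    (hXc : ∀ c : List Bool → Prop,
      (∀ f i, window f i (l + 1) <:+: w → window f i (l + 1) ∉ X →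
        c (window f i l) = c (window f (i + 1) l)) →
      ∀ f i, window f i (l + 1) ∈ X → c (window f i l) = c (window f (i + 1) l)) :
    factorCount w l + {e ∈ circuitEdges w | e.length = l + 1}.ncard + X.ncard ≤
      factorCount w (l + 1) + 1 := by
  set V : Set (List Bool) := {v | v <:+: w ∧ v.length = l} with hV
  set E : Set (List Bool) := {v | v <:+: w ∧ v.length = l + 1} with hE
  set D : Set (List Bool) := {e ∈ circuitEdges w | e.length = l + 1} with hD
  have hVfin : V.Finite := (finite_infixes w).subset fun _ h => h.1
  have hEfin : E.Finite := (finite_infixes w).subset fun _ h => h.1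
  have hDE : D ⊆ E := fun e he => ⟨infix_of_mem_circuitEdges he.1, he.2⟩
  have hDX : Disjoint D X := by
    rw [Set.disjoint_left]
    rintro e ⟨⟨g, m, hg, hm, he, -⟩, hlen⟩
    rw [hlen] at he hm
    rw [he]
    exact hX g m 0 hg.periodic hg.pos (by omega)
  have hDXE : D ∪ X ⊆ E := Set.union_subset hDE hXw
  have hcardDX : (D ∪ X).ncard = D.ncard + X.ncard :=
    Set.ncard_union_eq hDX (hEfin.subset hDE) (hEfin.subset hXw)
  have hcardE : (E \ (D ∪ X)).ncard + (D ∪ X).ncard = E.ncard :=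
    Set.ncard_sdiff_add_ncard_of_subset hDXE hEfin
  have hne : Nonempty V :=
    ⟨⟨window (extend w) 0 l, infix_window_extend (by omega), by simp⟩⟩
  have := hVfin.to_subtype
  have := (hEfin.subset (Set.sdiff_subset (t := D ∪ X))).to_subtype
  have key := card_le_card_add_one_of_coloring (V := V) (K := ↥(E \ (D ∪ X)))
    (fun e => ⟨e.1.dropLast, (dropLast_infix_self e.1).trans e.2.1.1, by
      simp [e.2.1.2]⟩)
    (fun e => ⟨e.1.tail, (List.tail_suffix e.1).isInfix.trans e.2.1.1, by
      simp [e.2.1.2]⟩) ?_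
  · rw [Nat.card_coe_set_eq, Nat.card_coe_set_eq] at key
    change V.ncard + D.ncard + X.ncard ≤ E.ncard + 1
    omega
  · intro c₀ hc₀
    set c : List Bool → Prop := fun v => ∃ h : v ∈ V, c₀ ⟨v, h⟩ with hcdef
    have hcV : ∀ v (h : v ∈ V), c v = c₀ ⟨v, h⟩ := fun v h => by simp [hcdef, h]
    have hkept : ∀ f i, window f i (l + 1) <:+: w → window f i (l + 1) ∉ circuitEdges w →
        window f i (l + 1) ∉ X → c (window f i l) = c (window f (i + 1) l) := by
      intro f i hw hD' hX'
      have hmem : window f i (l + 1) ∈ E \ (D ∪ X) :=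
        ⟨⟨hw, by simp⟩, fun h => h.elim (fun h => hD' h.1) hX'⟩
      have h := hc₀ ⟨_, hmem⟩
      rw [← hcV, ← hcV] at h
      rwa [window_dropLast, window_tail] at h
    have hcirc : ∀ f i, window f i (l + 1) <:+: w → window f i (l + 1) ∉ X →
        c (window f i l) = c (window f (i + 1) l) := by
      intro f i hw hX'
      by_cases hmem : window f i (l + 1) ∈ circuitEdges w
      · obtain ⟨g, m, hg, hm, heq, hall⟩ := hmem
        rw [length_window] at heq hall hm
        have h := coloring_eq_of_circuit hX hkept hg (by omega) hall 0
        rwa [← window_dropLast g, ← window_tail g, ← heq, window_dropLast, window_tail] at h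
      · exact hkept f i hw hmem hX'
    have hstep : ∀ f i, window f i (l + 1) <:+: w →
        c (window f i l) = c (window f (i + 1) l) := by
      intro f i hw
      by_cases hX' : window f i (l + 1) ∈ X
      · exact hXc c hcirc f i hX'
      · exact hcirc f i hw hX'
    have hwalk : ∀ i, i + l ≤ w.length →
        c (window (extend w) 0 l) = c (window (extend w) i l) := by
      intro i
      induction i with
      | zero => simp
      | succ i ih =>
        intro hi
        rw [ih (by omega)]
        exact hstep _ _ (infix_window_extend (by omega))
    have hall : ∀ v ∈ V, c (window (extend w) 0 l) = c v := by
      rintro v ⟨hv, hvl⟩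
      obtain ⟨i, hi, he⟩ := infix_iff_eq_window.1 hv
      rw [hvl] at hi he
      rw [he]
      exact hwalk i hi
    rintro ⟨x, hx⟩ ⟨y, hy⟩
    rw [← hcV, ← hcV, ← hall x hx, ← hall y hy]

/-- The Rauzy graph edge `aˡb` closes an additional circuit if `aˡ` occurs again after it. -/
theorem factorCount_add_ncard_add_one_le {l : ℕ} {x y z : List Bool} {w : List Bool}
    (hw : w = x ++ List.replicate l false ++ true :: y ++ List.replicate l false ++ z) :
    factorCount w l + {e ∈ circuitEdges w | e.length = l + 1}.ncard + 1 ≤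
      factorCount w (l + 1) + 1 := by
  have hlen : w.length = x.length + l + 1 + y.length + l + z.length := by
    rw [hw]
    simp
    omega
  set e : List Bool := List.replicate l false ++ [true] with he
  have hewin : ∀ f i, window f i (l + 1) = e ↔ window f i l = List.replicate l false ∧
      f (i + l) = true := by
    intro f i
    rw [window_add, he]
    constructor
    · intro h
      have := List.append_inj h (by simp)
      simpa [window] using this
    · rintro ⟨h₁, h₂⟩
      rw [h₁]
      simp [h₂, window]
  have hocc : ∀ u v, w = u ++ List.replicate l false ++ v →
      window (extend w) u.length l = List.replicate l false := by
    intro u v huv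
    have : List.replicate l false =
        window (extend w) u.length (List.replicate l false).length := by
      rw [eq_window_iff]
      intro t ht
      rw [List.length_replicate] at ht
      simp [extend, huv, List.getElem?_append, ht]
    simpa using this.symm
  have hp := hocc x (true :: y ++ List.replicate l false ++ z) (by simp [hw])
  have hq := hocc (x ++ List.replicate l false ++ true :: y) z (by simp [hw])
  have hpe : window (extend w) x.length (l + 1) = e := by
    refine (hewin _ _).2 ⟨hp, ?_⟩
    simp [extend, hw]
  suffices h : factorCount w l + {e ∈ circuitEdges w | e.length = l + 1}.ncard +
      ({e} : Set (List Bool)).ncard ≤ factorCount w (l + 1) + 1 by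
    rwa [Set.ncard_singleton] at h
  refine factorCount_add_ncard_le (by omega) ?_ ?_ ?_
  · rintro _ rfl
    exact ⟨hpe ▸ infix_window_extend (w := w) (i := x.length) (L := l + 1) (by omega),
      by simp [he]⟩
  · intro g m i hg hm hml hmem
    obtain ⟨h₁, h₂⟩ := (hewin g i).1 hmem
    have h₃ : List.replicate l false = window g i (List.replicate l false).length := by
      simp [h₁]
    rw [eq_window_iff] at h₃
    have h₄ := h₃ (l - m) (by simp; omega)
    rw [← hg, Nat.add_assoc, Nat.sub_add_cancel hml, h₂] at h₄
    simp at h₄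
  · intro c hc f i hfi
    rw [Set.mem_singleton_iff] at hfi
    classical
    have hex : ∃ q, x.length < q ∧ window (extend w) q l = List.replicate l false :=
      ⟨_, by simp, hq⟩
    obtain ⟨q, ⟨hxq, hq'⟩, hqle, hmin⟩ : ∃ q, (x.length < q ∧
        window (extend w) q l = List.replicate l false) ∧
        q ≤ (x ++ List.replicate l false ++ true :: y).length ∧
        ∀ p, x.length < p → p < q → window (extend w) p l ≠ List.replicate l false :=
      ⟨Nat.find hex, Nat.find_spec hex, Nat.find_min' hex ⟨by simp, hq⟩,
        fun p hp hpq heq => Nat.find_min hex hpq ⟨hp, heq⟩⟩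
    simp only [List.length_append, List.length_replicate, List.length_cons] at hqle
    have hwalk : ∀ s, x.length + 1 + s ≤ q →
        c (window (extend w) (x.length + 1) l) = c (window (extend w) (x.length + 1 + s) l) := by
      intro s
      induction s with
      | zero => simp
      | succ s ih =>
        intro hs
        rw [ih (by omega)]
        refine hc _ _ (infix_window_extend (by omega)) fun hmem => ?_
        exact hmin _ (by omega) (by omega) ((hewin _ _).1 (Set.mem_singleton_iff.1 hmem)).1
    have h := hwalk (q - (x.length + 1)) (by omega)
    rw [Nat.add_sub_cancel' (by omega), hq', ← hp, ← window_tail,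
      ← window_dropLast (extend w) x.length l, hpe] at h
    rw [← window_tail, ← window_dropLast f i l, hfi, h]

theorem ncard_circuitEdges_add_le {n : ℕ} {x y z : List Bool} {w : List Bool}
    (hw : w = x ++ List.replicate n false ++ true :: y ++ List.replicate n false ++ z)
    (hfalse : false ∈ w) : (circuitEdges w).ncard + n + 2 ≤ w.length := by
  have hlen : w.length = x.length + n + 1 + y.length + n + z.length := by
    rw [hw]
    simp
    omega
  have hone : 2 ≤ factorCount w 1 := by
    rw [← Set.ncard_pair (show [false] ≠ [true] by simp)]
    refine Set.ncard_le_ncard ?_ ((finite_infixes w).subset fun _ h => h.1)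
    rintro _ (rfl | rfl)
    · exact ⟨(List.singleton_infix_iff _ _).2 hfalse, rfl⟩
    · exact ⟨(List.singleton_infix_iff _ _).2 (by simp [hw]), rfl⟩
  have hsum : ∀ M, M < w.length →
      {e ∈ circuitEdges w | e.length ≤ M + 1}.ncard + min M n + 2 ≤
        factorCount w (M + 1) + M := by
    intro M
    induction M with
    | zero =>
      intro _
      have : {e ∈ circuitEdges w | e.length ≤ 0 + 1} = ∅ := by
        ext e
        simp only [Set.mem_ofPred_eq, Set.mem_empty_iff_false, iff_false, not_and]
        rintro ⟨g, m, hg, hm, -⟩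
        have := hg.pos
        omega
      simpa [this] using hone
    | succ M ih =>
      intro hM
      have hunion : {e ∈ circuitEdges w | e.length ≤ M + 1 + 1} =
          {e ∈ circuitEdges w | e.length ≤ M + 1} ∪
            {e ∈ circuitEdges w | e.length = M + 1 + 1} := by
        ext e
        simp only [Set.mem_ofPred_eq, Set.mem_union, ← and_or_left]
        exact and_congr_right fun _ => by omega
      have h₁ := Set.ncard_union_le {e ∈ circuitEdges w | e.length ≤ M + 1}
        {e ∈ circuitEdges w | e.length = M + 1 + 1}
      rw [← hunion] at h₁
      have h₂ := ih (by omega)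
      by_cases hMn : M + 1 ≤ n
      · have h₃ := factorCount_add_ncard_add_one_le (l := M + 1)
          (x := x ++ List.replicate (n - (M + 1)) false)
          (y := y ++ List.replicate (n - (M + 1)) false)
          (z := z) (w := w) (by
            obtain ⟨d, rfl⟩ := Nat.exists_eq_add_of_le hMn
            simp [hw, Nat.add_comm (M + 1) d, List.replicate_add, -List.replicate_append_replicate])
        omega
      · have h₃ := factorCount_add_ncard_le (l := M + 1) (w := w) (X := ∅) hM
          (by simp) (by simp) (by simp)
        rw [Set.ncard_empty] at h₃
        omega
  have h₁ := hsum (w.length - 1) (by omega)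
  rw [Nat.sub_add_cancel (by omega), Nat.min_eq_right (by omega)] at h₁
  have hall : {e ∈ circuitEdges w | e.length ≤ w.length} = circuitEdges w :=
    Set.sep_eq_self_iff_mem_true.2 fun e he => (infix_of_mem_circuitEdges he).length_le
  have hlast : factorCount w w.length ≤ 1 := by
    rw [factorCount, Set.ncard_le_one ((finite_infixes w).subset fun _ h => h.1)]
    rintro a ⟨ha, hal⟩ b ⟨hb, hbl⟩
    rw [ha.eq_of_length hal, hb.eq_of_length hbl]
  rw [hall] at h₁
  omega

/-- Powers of odd length are not squares. -/
theorem numSquares_add_ncard_le_numPowers {w : List Bool} {O : Set (List Bool)}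
    (hO : ∀ v ∈ O, v <:+: w ∧ Odd v.length ∧
      ∃ u : List Bool, u ≠ [] ∧ ∃ j : ℕ, 2 ≤ j ∧ v = (List.replicate j u).flatten) :
    numSquares w + O.ncard ≤ numPowers w := by
  rw [numSquares, ← Set.ncard_union_eq _ ((finite_infixes w).subset fun _ h => h.1)
    ((finite_infixes w).subset fun _ h => (hO _ h).1)]
  · refine Set.ncard_le_ncard ?_ ((finite_infixes w).subset fun _ h => h.1)
    rintro v (⟨hv, u, hu, rfl⟩ | hv)
    · exact ⟨hv, u, hu, 2, le_rfl, by simp [List.replicate_succ]⟩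
    · exact ⟨(hO v hv).1, (hO v hv).2.2⟩
  · rw [Set.disjoint_left]
    rintro v ⟨-, u, -, rfl⟩ hv
    have := (hO _ hv).2.1
    rw [List.length_append, ← Nat.not_even_iff_odd] at this
    exact this ⟨_, rfl⟩

/-- The powers of `a` of odd length at least three and at most `R`. -/
def oddRuns (R : ℕ) : Finset (List Bool) :=
  (Finset.range ((R - 1) / 2)).image fun i => List.replicate (2 * i + 3) false

theorem card_oddRuns (R : ℕ) : (oddRuns R).card = (R - 1) / 2 := by
  rw [oddRuns, Finset.card_image_of_injective, Finset.card_range]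
  intro i j h
  have := congrArg List.length h
  simp only [List.length_replicate] at this
  omega

theorem oddRuns_spec {w v : List Bool} {R : ℕ} (hR : List.replicate R false <:+: w)
    (hv : v ∈ oddRuns R) : v <:+: w ∧ Odd v.length ∧
      ∃ u : List Bool, u ≠ [] ∧ ∃ j : ℕ, 2 ≤ j ∧ v = (List.replicate j u).flatten := by
  simp only [oddRuns, Finset.mem_image, Finset.mem_range] at hv
  obtain ⟨i, hi, rfl⟩ := hv
  refine ⟨List.IsInfix.trans ?_ hR, ⟨i + 1, by simp; omega⟩, [false], by simp,
    2 * i + 3, by omega, by simp⟩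
  obtain ⟨d, hd⟩ := Nat.exists_eq_add_of_le (show 2 * i + 3 ≤ R by omega)
  rw [hd, List.replicate_add (2 * i + 3)]
  exact (List.prefix_append _ _).isInfix

theorem numSquares_add_le {n R : ℕ} {x y z : List Bool} {w : List Bool}
    (hw : w = x ++ List.replicate n false ++ true :: y ++ List.replicate n false ++ z)
    (hfalse : false ∈ w) (hR : List.replicate R false <:+: w) :
    numSquares w + (R - 1) / 2 + n + 2 ≤ w.length := by
  have h₁ := ncard_circuitEdges_add_le hw hfalse
  have h₂ := numPowers_le_ncard_circuitEdges w
  have h₃ := numSquares_add_ncard_le_numPowers (w := w) (O := oddRuns R) fun v hv =>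
    oddRuns_spec hR hv
  rw [Set.ncard_coe_finset, card_oddRuns] at h₃
  omega

theorem numSquares_add_lt {n R : ℕ} {x y z : List Bool} {w : List Bool}
    (hw : w = x ++ List.replicate n false ++ true :: y ++ List.replicate n false ++ z)
    (hfalse : false ∈ w) (hR : List.replicate R false <:+: w) {u : List Bool}
    (hu : true ∈ u) (hodd : Odd u.length) (hcube : (List.replicate 3 u).flatten <:+: w) :
    numSquares w + (R - 1) / 2 + n + 2 < w.length := by
  classical
  have h₁ := ncard_circuitEdges_add_le hw hfalse
  have h₂ := numPowers_le_ncard_circuitEdges w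
  have hmem : (List.replicate 3 u).flatten ∉ oddRuns R := by
    simp only [oddRuns, Finset.mem_image, not_exists, not_and]
    intro i _ heq
    have : true ∈ (List.replicate 3 u).flatten := by simp [hu]
    rw [← heq] at this
    simp at this
  have h₃ := numSquares_add_ncard_le_numPowers (w := w)
    (O := ↑(insert (List.replicate 3 u).flatten (oddRuns R))) fun v hv => by
      rw [Finset.mem_coe, Finset.mem_insert] at hv
      obtain rfl | hv := hv
      · refine ⟨hcube, ?_, u, List.ne_nil_of_mem hu, 3, by omega, rfl⟩
        rw [List.length_flatten, List.map_replicate, List.sum_replicate, smul_eq_mul]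
        exact Odd.mul (by decide) hodd
      · exact oddRuns_spec hR hv
  rw [Set.ncard_coe_finset, Finset.card_insert_of_notMem hmem, card_oddRuns] at h₃
  omega

theorem binWord_append_true (k : ℕ) (r : Fin (k + 1) → ℕ) :
    binWord k r ++ [true] =
      (List.ofFn r).flatMap fun n => List.replicate n false ++ [true] := by
  rw [List.ofFn_succ', List.concat_eq_append, List.flatMap_append, List.flatMap_singleton, binWord,
    List.append_assoc, List.flatMap, List.map_ofFn]
  rfl

theorem count_false_binWord (k : ℕ) (r : Fin (k + 1) → ℕ) :
    (binWord k r).count false = ∑ i, r i := by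
  have h := congrArg (List.count false) (binWord_append_true k r)
  rw [List.count_append, List.count_flatMap, List.map_ofFn, List.sum_ofFn] at h
  simpa [List.count_replicate] using h

theorem count_true_binWord (k : ℕ) (r : Fin (k + 1) → ℕ) :
    (binWord k r).count true = k := by
  have h := congrArg (List.count true) (binWord_append_true k r)
  rw [List.count_append, List.count_flatMap, List.map_ofFn, List.sum_ofFn] at h
  simpa [List.count_replicate] using h

theorem eq_append_dropLast {α : Type*} {w x y : List α} {a : α} (h : w ++ [a] = x ++ y)
    (hy : y ≠ []) : w = x ++ y.dropLast := by
  rw [← List.dropLast_append_of_ne_nil hy, ← h, List.dropLast_concat]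

theorem binWord_eq_of_ofFn_eq {k : ℕ} {r : Fin (k + 1) → ℕ} {X Y Z : List ℕ} {p q n : ℕ}
    (h : List.ofFn r = X ++ p :: Y ++ q :: Z) (hp : n ≤ p) (hq : n ≤ q) :
    ∃ x y z, binWord k r =
      x ++ List.replicate n false ++ true :: y ++ List.replicate n false ++ z := by
  obtain ⟨c, rfl⟩ := Nat.exists_eq_add_of_le' hp
  obtain ⟨d, rfl⟩ := Nat.exists_eq_add_of_le hq
  set f : ℕ → List Bool := fun n => List.replicate n false ++ [true]
  have hw := binWord_append_true k r
  rw [h] at hw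
  refine ⟨X.flatMap f ++ List.replicate c false, Y.flatMap f, _,
    eq_append_dropLast (a := true)
      (y := List.replicate d false ++ true :: Z.flatMap f) ?_ (by simp)⟩
  rw [hw]
  simp [f, List.replicate_add, -List.replicate_append_replicate]

theorem flatMap_infix_binWord {k : ℕ} {r : Fin (k + 1) → ℕ} {X Y Z : List ℕ}
    (h : List.ofFn r = X ++ Y ++ Z) (hZ : Z ≠ []) :
    (Y.flatMap fun n => List.replicate n false ++ [true]) <:+: binWord k r := by
  have hw := binWord_append_true k r
  rw [h, List.flatMap_append, List.flatMap_append] at hw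
  have hne : (Z.flatMap fun n => List.replicate n false ++ [true]) ≠ [] := by
    obtain ⟨z, Z, rfl⟩ := List.exists_cons_of_ne_nil hZ
    simp
  exact ⟨_, _, (eq_append_dropLast hw hne).symm⟩

theorem replicate_infix_binWord {k : ℕ} (r : Fin (k + 1) → ℕ) (i : Fin (k + 1)) :
    List.replicate (r i) false <:+: binWord k r := by
  have hw := binWord_append_true k r
  obtain ⟨X, Y, hXY⟩ := List.append_of_mem ((List.mem_ofFn' r _).2 ⟨i, rfl⟩)
  rw [hXY, List.flatMap_append, List.flatMap_cons, List.append_assoc, ← List.append_assoc] at hw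
  exact ⟨_, _, (eq_append_dropLast hw (by simp)).symm⟩

theorem ofFn_eq_append {k : ℕ} (r : Fin (k + 1) → ℕ) {i j : Fin (k + 1)} (hij : i < j) :
    ∃ X Y Z, List.ofFn r = X ++ r i :: Y ++ r j :: Z := by
  refine ⟨(List.ofFn r).take i, ((List.ofFn r).take j).drop (i + 1),
    (List.ofFn r).drop (j + 1), ?_⟩
  have h₁ : (List.ofFn r).drop j = r j :: (List.ofFn r).drop (j + 1) := by
    rw [List.drop_eq_getElem_cons (by rw [List.length_ofFn]; exact j.2)]
    simp [-List.ofFn_succ]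
  have h₂ : ((List.ofFn r).take j).drop i = r i :: ((List.ofFn r).take j).drop (i + 1) := by
    rw [List.drop_eq_getElem_cons (by simp; omega)]
    simp [-List.ofFn_succ]
  rw [← h₁, ← h₂]
  conv_lhs => rw [← List.take_append_drop j (List.ofFn r),
    ← List.take_append_drop i ((List.ofFn r).take j), List.take_take, Nat.min_eq_left hij.le]

theorem cube_infix_binWord {k : ℕ} (r : Fin (k + 1) → ℕ) {R t : ℕ} (ht : t + 3 ≤ k)
    (hr : ∀ s (hs : s < 3), r ⟨t + s, by omega⟩ = R) :
    (List.replicate 3 (List.replicate R false ++ [true])).flatten <:+: binWord k r := by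
  have h : List.ofFn r = (List.ofFn r).take t ++ [R, R, R] ++ (List.ofFn r).drop (t + 3) := by
    conv_lhs => rw [← List.take_append_drop t (List.ofFn r),
      List.drop_eq_getElem_cons (by simp; omega), List.drop_eq_getElem_cons (by simp; omega),
      List.drop_eq_getElem_cons (by simp; omega)]
    have h₀ := hr 0 (by omega)
    have h₁ := hr 1 (by omega)
    have h₂ := hr 2 (by omega)
    simp_all [Nat.add_assoc, -List.ofFn_succ]
  have := flatMap_infix_binWord h (by
    rw [← List.length_pos_iff]
    simp
    omega)
  simpa [List.replicate_succ] using this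

theorem le_sum_range_mul_three {d : ℕ → ℕ} {n : ℕ}
    (h : ∀ t < n, ∃ s < 3, 0 < d (3 * t + s)) : n ≤ ∑ i ∈ Finset.range (3 * n), d i := by
  induction n with
  | zero => simp
  | succ n ih =>
    have h₁ := ih fun t ht => h t (by omega)
    obtain ⟨s, hs, hd⟩ := h n (by omega)
    rw [Nat.mul_succ, Finset.sum_range_succ, Finset.sum_range_succ, Finset.sum_range_succ]
    interval_cases s
    · rw [Nat.add_zero] at hd
      omega
    all_goals omega

/-- If runs of length less than `R` are rare, there are three consecutive runs of length `R`. -/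
theorem exists_three_consecutive {k R : ℕ} {r : Fin (k + 1) → ℕ} (hr : ∀ i, r i ≤ R) {D : ℕ}
    (hD : (k + 1) * R ≤ ∑ i, r i + D) (hk : 3 * D + 3 ≤ k) :
    ∃ t, t + 3 ≤ k ∧ ∀ s < 3, ∀ hs : t + s < k + 1, r ⟨t + s, hs⟩ = R := by
  by_contra! hcon
  set d : ℕ → ℕ := fun i => if h : i < k + 1 then R - r ⟨i, h⟩ else 0 with hd
  have hlow : D + 1 ≤ ∑ i ∈ Finset.range (3 * (D + 1)), d i := by
    refine le_sum_range_mul_three fun t ht => ?_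
    obtain ⟨s, hs, hlt, hne⟩ := hcon (3 * t) (by omega)
    refine ⟨s, hs, ?_⟩
    have := hr ⟨3 * t + s, hlt⟩
    simp only [hd, dif_pos hlt]
    omega
  have hup : ∑ i ∈ Finset.range (3 * (D + 1)), d i ≤ ∑ i ∈ Finset.range (k + 1), d i :=
    Finset.sum_le_sum_of_subset (Finset.range_mono (by omega))
  have hsum : ∑ i ∈ Finset.range (k + 1), d i + ∑ i, r i = (k + 1) * R := by
    rw [Finset.sum_range, ← Finset.sum_add_distrib]
    simp only [hd, Fin.is_lt, dif_pos, Fin.eta]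
    rw [Finset.sum_congr rfl fun i _ => Nat.sub_add_cancel (hr i)]
    simp
  omega

theorem squares_arithmetic {k n δ R S s : ℕ} (hn : n = δ / (k + 1))
    (h : 1 + 3 * (n + 1) / 2 ≤ (R - 1) / 2 + S) (hSR : S ≤ R) (hle : k + δ ≤ k * S + R)
    (hbound : s + (R - 1) / 2 + S + 2 ≤ 2 * k + δ)
    (hsharp : ∀ p, R = 2 * p → S = R → ∀ D, (k + 1) * R ≤ k + δ + D → 3 * D + 3 ≤ k →
      s + (R - 1) / 2 + S + 2 < 2 * k + δ) :
    s * (2 * k + 2) + (2 * k + δ) ≤ 2 * k * (2 * k + δ) := by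
  have key : ∀ c, s + c ≤ 2 * k + δ → 3 * (2 * k + δ) ≤ c * (2 * k + 2) →
      s * (2 * k + 2) + (2 * k + δ) ≤ 2 * k * (2 * k + δ) := fun c h₁ h₂ => by
    have := Nat.mul_le_mul_right (2 * k + 2) h₁
    linarith
  obtain ⟨ρ, hρ, hδ⟩ : ∃ ρ ≤ k, δ = n * (k + 1) + ρ :=
    ⟨δ % (k + 1), Nat.lt_succ_iff.1 (Nat.mod_lt _ (by omega)), by
      rw [hn, Nat.mul_comm, Nat.div_add_mod]⟩
  obtain ⟨p, rfl | rfl⟩ := Nat.even_or_odd' n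
  · by_cases h₁ : 3 * p + 3 ≤ (R - 1) / 2 + S
    · exact key (3 * p + 5) (by omega) (by rw [hδ]; linarith)
    by_cases h₂ : 3 * (2 * k + δ) ≤ (3 * p + 4) * (2 * k + 2)
    · exact key _ (by omega) h₂
    have hρk : 2 * k + 8 < 3 * ρ := by
      rw [hδ] at h₂
      linarith
    have hS : 2 * p + 2 ≤ S := by
      by_contra! hlt
      obtain ⟨c, hc⟩ := Nat.exists_eq_add_of_le (Nat.le_of_lt_succ hlt)
      have e : k * (2 * p + 1) = k * S + k * c := by rw [hc, Nat.mul_add]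
      have hkc : 2 * c ≤ k * c := Nat.mul_le_mul_right c (by omega)
      have hR : R ≤ 2 * p + 4 + 2 * c := by omega
      rw [hδ] at hle
      linarith
    have hlt := hsharp (p + 1) (by omega) (by omega) (k + 2 - ρ) (by
      have hR : R = 2 * p + 2 := by omega
      have e : ρ + (k + 2 - ρ) = k + 2 := by omega
      rw [hδ, hR]
      linarith) (by omega)
    exact key (3 * p + 5) (by omega) (by rw [hδ]; linarith)
  · exact key (3 * p + 6) (by omega) (by rw [hδ]; linarith)

theorem reduction_arithmetic_criterion
    (k : ℕ) (hk : 1 ≤ k) (r : Fin (k + 1) → ℕ) (δ n : ℕ)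
    (hab : (binWord k r).count true ≤ (binWord k r).count false)
    (hδ : (binWord k r).count false = k + δ)
    (hn : n = δ / (k + 1))
    (σ : Equiv.Perm (Fin (k + 1)))
    (hσ : Monotone fun j => r (σ j))
    (h : 1 + 3 * (n + 1) / 2 ≤ (r (σ (Fin.last k)) - 1) / 2 + r (σ ⟨k - 1, by omega⟩)) :
    (numSquares (binWord k r) : ℚ) ≤ (2 * k - 1) / (2 * k + 2) * (binWord k r).length := by
  have hsum := count_false_binWord k r
  have hlen : (binWord k r).length = 2 * k + δ := by
    rw [← List.count_not_add_count (binWord k r) true, count_true_binWord]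
    simp only [Bool.not_true, hδ]
    omega
  have hfalse : false ∈ binWord k r := List.count_pos_iff.1 (by omega)
  rw [hδ] at hsum
  set S := r (σ ⟨k - 1, by omega⟩) with hS
  set R := r (σ (Fin.last k)) with hR
  have hSR : S ≤ R := hσ (Fin.le_last _)
  have hRmax : ∀ i, r i ≤ R := fun i => by
    simpa using hσ (Fin.le_last (σ.symm i))
  have hle : ∑ i, r i ≤ k * S + R := by
    rw [← Equiv.sum_comp σ, Fin.sum_univ_castSucc]
    refine Nat.add_le_add_right ((Finset.sum_le_card_nsmul _ _ S fun i _ => ?_).trans (by simp)) _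
    exact hσ (Fin.le_def.2 (by simp; omega))
  obtain ⟨x, y, z, hw⟩ : ∃ x y z, binWord k r =
      x ++ List.replicate S false ++ true :: y ++ List.replicate S false ++ z := by
    have hne : σ ⟨k - 1, by omega⟩ ≠ σ (Fin.last k) := fun heq => by
      have := congrArg Fin.val (σ.injective heq)
      simp at this
      omega
    rcases lt_or_gt_of_ne hne with hlt | hlt
    · obtain ⟨X, Y, Z, h⟩ := ofFn_eq_append r hlt
      exact binWord_eq_of_ofFn_eq h le_rfl hSR
    · obtain ⟨X, Y, Z, h⟩ := ofFn_eq_append r hlt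
      exact binWord_eq_of_ofFn_eq h hSR le_rfl
  have hbound := numSquares_add_le hw hfalse (replicate_infix_binWord r (σ (Fin.last k)))
  have hsharp : ∀ p, R = 2 * p → S = R → ∀ D, (k + 1) * R ≤ ∑ i, r i + D → 3 * D + 3 ≤ k →
      numSquares (binWord k r) + (R - 1) / 2 + S + 2 < (binWord k r).length := by
    intro p hp hSR D hD hk
    obtain ⟨t, ht, hr⟩ := exists_three_consecutive hRmax hD hk
    refine numSquares_add_lt hw hfalse (replicate_infix_binWord r (σ (Fin.last k)))
      (by simp) ⟨p, ?_⟩ (cube_infix_binWord r ht fun s hs => hr s hs _)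
    simp [hp]
  rw [hlen] at hbound hsharp ⊢
  rw [← hsum] at hsharp hle
  have hnat := squares_arithmetic hn h hSR hle hbound hsharp
  have hq : (numSquares (binWord k r) : ℚ) * (2 * k + 2) + (2 * k + δ) ≤ 2 * k * (2 * k + δ) := by
    exact_mod_cast hnat
  push_cast
  rw [div_mul_eq_mul_div, le_div_iff₀ (by positivity)]
  linarith
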